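/- Let Ω ⊂⊂ ℂⁿ be a bounded pseudoconvex domain with C^k (k ≥ 3)-smooth boundary, ρ a defining function of Ω, α = α_ρ the D'Angelo 1-form of ρ, and L a (1,0) vector field defined on a neighborhood of ∂Ω with Lρ = 0. Then at every point p ∈ Σ_L := { p ∈ ∂Ω : Levi_ρ(L,L)(p) = 0 }, |Levi_ρ(L,N)|²/‖∇ρ‖² + (1/2)(N Levi_ρ(L,L))/‖∇ρ‖ = (i/8)(d^c α)(L, L̄), where N := (Σ_j |∂ρ/∂z_j|²)^{-1/2} Σ_j (∂ρ/∂z̄_j) ∂/∂z_j, ∇ρ is the real gradient of ρ, and d^c := i(∂̄ − ∂). -/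

import Mathlib

open Complex
open scoped ComplexOrder

noncomputable section

/-- Points of ℂⁿ. -/
abbrev Pt (n : ℕ) := Fin n → ℂ

/-- Wirtinger derivative ∂f/∂z_j at z (junk value if f is not differentiable). -/
def dZ (n : ℕ) (f : Pt n → ℂ) (j : Fin n) (z : Pt n) : ℂ :=
  (1 / 2 : ℂ) * (fderiv ℝ f z (Pi.single j 1) - Complex.I * fderiv ℝ f z (Pi.single j Complex.I))

/-- Wirtinger derivative ∂f/∂z̄_j at z. -/
def dZb (n : ℕ) (f : Pt n → ℂ) (j : Fin n) (z : Pt n) : ℂ :=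
  (1 / 2 : ℂ) * (fderiv ℝ f z (Pi.single j 1) + Complex.I * fderiv ℝ f z (Pi.single j Complex.I))

/-- Complexification of a real-valued function. -/
def cR (n : ℕ) (ρ : Pt n → ℝ) : Pt n → ℂ := fun z => (ρ z : ℂ)

/-- Levi form of ρ at z: Levi_ρ(X,Y) = Σ_{j,k} ∂²ρ/∂z_j∂z̄_k X_j conj(Y_k), where X, Y are
(1,0)-vectors given by their coefficient tuples. -/
def levi (n : ℕ) (ρ : Pt n → ℝ) (z : Pt n) (X Y : Fin n → ℂ) : ℂ :=
  ∑ j, ∑ k, dZ n (fun w => dZb n (cR n ρ) k w) j z * X j * (starRingEnd ℂ) (Y k)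

/-- Holomorphic tangent space T^{1,0}_p(∂Ω) (for boundary points p), described via a defining
function: (1,0)-vectors X with Σ_j X_j ∂ρ/∂z_j(p) = 0. -/
def T10 (n : ℕ) (ρ : Pt n → ℝ) (p : Pt n) : Set (Fin n → ℂ) :=
  {X | ∑ j, X j * dZ n (cR n ρ) j p = 0}

/-- Null space of the Levi form inside T^{1,0}_p(∂Ω). -/
def nullSp (n : ℕ) (ρ : Pt n → ℝ) (p : Pt n) : Set (Fin n → ℂ) :=
  {X | X ∈ T10 n ρ p ∧ ∀ Y ∈ T10 n ρ p, levi n ρ p X Y = 0}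

/-- ρ is a C^s defining function of Ω on the neighborhood V of the closure of Ω. -/
def IsDefining (n : ℕ) (s : ℕ∞) (Ω : Set (Pt n)) (ρ : Pt n → ℝ) (V : Set (Pt n)) : Prop :=
  IsOpen V ∧ closure Ω ⊆ V ∧ ContDiffOn ℝ s ρ V ∧
    Ω = {z | z ∈ V ∧ ρ z < 0} ∧ ∀ z ∈ frontier Ω, fderiv ℝ ρ z ≠ 0

/-- Strict plurisubharmonicity on a set, via positivity of the Levi form. -/
def StrictPSHOn (n : ℕ) (f : Pt n → ℝ) (s : Set (Pt n)) : Prop :=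
  ∀ z ∈ s, ∀ X : Fin n → ℂ, X ≠ 0 → 0 < (levi n f z X X).re

/-- Diederich–Fornaess exponent of a defining function ρ (0 if the defining set is empty). -/
def DFexp (n : ℕ) (ρ : Pt n → ℝ) (Ω : Set (Pt n)) : ℝ :=
  sSup {η : ℝ | 0 < η ∧ η < 1 ∧ StrictPSHOn n (fun z => -((-ρ z) ^ η)) Ω}

/-- Diederich–Fornaess index of Ω: supremum over all (C¹) defining functions. -/
def DFindex (n : ℕ) (Ω : Set (Pt n)) : ℝ :=
  sSup {e : ℝ | ∃ ρ V, IsDefining n 1 Ω ρ V ∧ e = DFexp n ρ Ω}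

/-- Steinness exponent of a defining function ρ (⊤ = ∞ if the defining set is empty). -/
def Sexp (n : ℕ) (ρ : Pt n → ℝ) (Ω : Set (Pt n)) : EReal :=
  sInf {e : EReal | ∃ η : ℝ, 1 < η ∧
    (∃ U : Set (Pt n), IsOpen U ∧ frontier Ω ⊆ U ∧
      StrictPSHOn n (fun z => ρ z ^ η) ((closure Ω)ᶜ ∩ U)) ∧ e = (η : EReal)}

/-- Steinness index of Ω: infimum over all (C¹) defining functions. -/
def Sindex (n : ℕ) (Ω : Set (Pt n)) : EReal :=
  sInf {e : EReal | ∃ ρ V, IsDefining n 1 Ω ρ V ∧ e = Sexp n ρ Ω}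

/-- A complex vector field Σ_j a_j ∂/∂z_j + Σ_j b_j ∂/∂z̄_j on ℂⁿ, recorded by its
coefficient functions. -/
structure VF (n : ℕ) where
  a : Pt n → Fin n → ℂ
  b : Pt n → Fin n → ℂ

/-- Action of a complex vector field on a function. -/
def VF.app {n : ℕ} (V : VF n) (f : Pt n → ℂ) (z : Pt n) : ℂ :=
  ∑ j, V.a z j * dZ n f j z + ∑ j, V.b z j * dZb n f j z

/-- The value of a vector field at a point, as a pair ((1,0)-part, (0,1)-part). -/
def VF.atPt {n : ℕ} (V : VF n) (p : Pt n) : (Fin n → ℂ) × (Fin n → ℂ) := (V.a p, V.b p)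

/-- A complex 1-form Σ_j w_j dz_j + Σ_j t_j dz̄_j on ℂⁿ. -/
structure Form1 (n : ℕ) where
  w : Pt n → Fin n → ℂ
  t : Pt n → Fin n → ℂ

/-- Value of a 1-form at a point on a complex tangent vector (pair of (1,0) and (0,1) parts). -/
def Form1.eval {n : ℕ} (η : Form1 n) (z : Pt n) (X : (Fin n → ℂ) × (Fin n → ℂ)) : ℂ :=
  ∑ j, η.w z j * X.1 j + ∑ j, η.t z j * X.2 j

/-- Pairing of a 1-form with a vector field. -/
def Form1.app {n : ℕ} (η : Form1 n) (V : VF n) (z : Pt n) : ℂ :=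
  η.eval z (V.atPt z)

/-- Lie bracket of complex vector fields. -/
def VF.bracket {n : ℕ} (V W : VF n) : VF n :=
  ⟨fun z j => V.app (fun w => W.a w j) z - W.app (fun w => V.a w j) z,
   fun z j => V.app (fun w => W.b w j) z - W.app (fun w => V.b w j) z⟩

/-- Levi-Civita covariant derivative ∇_V W of the Euclidean metric (componentwise derivative). -/
def covD {n : ℕ} (V W : VF n) : VF n :=
  ⟨fun z j => V.app (fun w => W.a w j) z, fun z j => V.app (fun w => W.b w j) z⟩

/-- Lie derivative of a 1-form along a vector field, in coordinates. -/
def lieD {n : ℕ} (T : VF n) (η : Form1 n) : Form1 n :=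
  ⟨fun z j => T.app (fun w => η.w w j) z + ∑ m, η.w z m * dZ n (fun w => T.a w m) j z
      + ∑ m, η.t z m * dZ n (fun w => T.b w m) j z,
   fun z j => T.app (fun w => η.t w j) z + ∑ m, η.w z m * dZb n (fun w => T.a w m) j z
      + ∑ m, η.t z m * dZb n (fun w => T.b w m) j z⟩

/-- Negation of a 1-form. -/
def Form1.neg {n : ℕ} (η : Form1 n) : Form1 n := ⟨fun z j => -η.w z j, fun z j => -η.t z j⟩

/-- Σ_j |∂ρ/∂z_j|². -/
def gradSq (n : ℕ) (ρ : Pt n → ℝ) (z : Pt n) : ℝ :=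
  ∑ j, Complex.normSq (dZ n (cR n ρ) j z)

/-- Norm of the real gradient of ρ: ‖∇ρ‖ = 2 (Σ_j |∂ρ/∂z_j|²)^{1/2}. -/
def gradNorm (n : ℕ) (ρ : Pt n → ℝ) (z : Pt n) : ℝ := 2 * Real.sqrt (gradSq n ρ z)

/-- The (1,0) field L_n = (Σ|∂ρ/∂z_j|²)⁻¹ Σ_j (∂ρ/∂z̄_j) ∂/∂z_j. -/
def LnVF (n : ℕ) (ρ : Pt n → ℝ) : VF n :=
  ⟨fun z j => dZb n (cR n ρ) j z / (gradSq n ρ z : ℂ), fun _ _ => 0⟩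

/-- The (1,0) field N = (Σ|∂ρ/∂z_j|²)^{-1/2} Σ_j (∂ρ/∂z̄_j) ∂/∂z_j. -/
def NVF (n : ℕ) (ρ : Pt n → ℝ) : VF n :=
  ⟨fun z j => dZb n (cR n ρ) j z / ((Real.sqrt (gradSq n ρ z) : ℝ) : ℂ), fun _ _ => 0⟩

/-- T = L_n − conj(L_n). -/
def TVF (n : ℕ) (ρ : Pt n → ℝ) : VF n :=
  ⟨fun z j => (LnVF n ρ).a z j, fun z j => -(starRingEnd ℂ) ((LnVF n ρ).a z j)⟩

/-- η = (1/2)(∂ρ − ∂̄ρ). -/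
def etaF (n : ℕ) (ρ : Pt n → ℝ) : Form1 n :=
  ⟨fun z j => (1 / 2 : ℂ) * dZ n (cR n ρ) j z,
   fun z j => -(1 / 2 : ℂ) * dZb n (cR n ρ) j z⟩

/-- The D'Angelo 1-form α_ρ = −Lie_T η of a defining function ρ. -/
def dAngelo (n : ℕ) (ρ : Pt n → ℝ) : Form1 n := Form1.neg (lieD (TVF n ρ) (etaF n ρ))

/-- Evaluation of the (1,0)-part ∂η of the exterior derivative of a 1-form on two
complex tangent vectors. -/
def delEval {n : ℕ} (η : Form1 n) (X Y : (Fin n → ℂ) × (Fin n → ℂ)) (z : Pt n) : ℂ :=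
  (∑ m, ∑ l, dZ n (fun w => η.w w l) m z * (X.1 m * Y.1 l - Y.1 m * X.1 l)) +
  (∑ m, ∑ l, dZ n (fun w => η.t w l) m z * (X.1 m * Y.2 l - Y.1 m * X.2 l))

/-- Evaluation of ∂̄η of a 1-form η on two complex tangent vectors. -/
def delbEval {n : ℕ} (η : Form1 n) (X Y : (Fin n → ℂ) × (Fin n → ℂ)) (z : Pt n) : ℂ :=
  (∑ m, ∑ l, dZb n (fun w => η.w w l) m z * (X.2 m * Y.1 l - Y.2 m * X.1 l)) +
  (∑ m, ∑ l, dZb n (fun w => η.t w l) m z * (X.2 m * Y.2 l - Y.2 m * X.2 l))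

/-- Evaluation of dη = ∂η + ∂̄η. -/
def dEval {n : ℕ} (η : Form1 n) (X Y : (Fin n → ℂ) × (Fin n → ℂ)) (z : Pt n) : ℂ :=
  delEval η X Y z + delbEval η X Y z

/-- Evaluation of d^c η = i(∂̄ − ∂)η. -/
def dcEval {n : ℕ} (η : Form1 n) (X Y : (Fin n → ℂ) × (Fin n → ℂ)) (z : Pt n) : ℂ :=
  Complex.I * (delbEval η X Y z - delEval η X Y z)

/-- Evaluation of ω ∧ ω̄ on two complex tangent vectors, where ω = π_{1,0} η is the
(1,0)-component of the real 1-form η. -/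
def omegaWedge {n : ℕ} (η : Form1 n) (X Y : (Fin n → ℂ) × (Fin n → ℂ)) (z : Pt n) : ℂ :=
  (∑ j, η.w z j * X.1 j) * (∑ j, (starRingEnd ℂ) (η.w z j) * Y.2 j) -
  (∑ j, η.w z j * Y.1 j) * (∑ j, (starRingEnd ℂ) (η.w z j) * X.2 j)

/-- Evaluation of ∂̄ω where ω = π_{1,0} η. -/
def delbOmega {n : ℕ} (η : Form1 n) (X Y : (Fin n → ℂ) × (Fin n → ℂ)) (z : Pt n) : ℂ :=
  delbEval ⟨η.w, fun _ _ => 0⟩ X Y z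

/-- The standard Euclidean complex Hermitian metric g on complexified tangent vectors
(so that g(∂/∂z_j, ∂/∂z_j) = 1/2). -/
def gMet {n : ℕ} (X Y : (Fin n → ℂ) × (Fin n → ℂ)) : ℂ :=
  (1 / 2 : ℂ) * (∑ j, X.1 j * (starRingEnd ℂ) (Y.1 j) + ∑ j, X.2 j * (starRingEnd ℂ) (Y.2 j))

/-- The real gradient ∇ρ as a complex vector field: 2Σ_j (∂ρ/∂z̄_j ∂/∂z_j + ∂ρ/∂z_j ∂/∂z̄_j). -/
def gradVF (n : ℕ) (ρ : Pt n → ℝ) : VF n :=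
  ⟨fun z j => 2 * dZb n (cR n ρ) j z, fun z j => 2 * dZ n (cR n ρ) j z⟩

/-- Pseudoconvexity of Ω (w.r.t. the defining function ρ): the Levi form is positive
semidefinite on the holomorphic tangent spaces of the boundary. -/
def LeviPseudoconvex (n : ℕ) (ρ : Pt n → ℝ) (Ω : Set (Pt n)) : Prop :=
  ∀ p ∈ frontier Ω, ∀ X ∈ T10 n ρ p, 0 ≤ (levi n ρ p X X).re

/-- The set Σ of weakly pseudoconvex boundary points. -/
def weakPts (n : ℕ) (ρ : Pt n → ℝ) (Ω : Set (Pt n)) : Set (Pt n) :=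
  {p | p ∈ frontier Ω ∧ ∃ X ∈ T10 n ρ p, X ≠ 0 ∧ levi n ρ p X X = 0}

/-- Action of a complex tangent vector at p on a function. -/
def vecApp (n : ℕ) (X : (Fin n → ℂ) × (Fin n → ℂ)) (f : Pt n → ℂ) (p : Pt n) : ℂ :=
  ∑ j, X.1 j * dZ n f j p + ∑ j, X.2 j * dZb n f j p

/-- Pushforward (complexified differential) of a complex tangent vector at p by a map f. -/
def push (n : ℕ) (f : Pt n → Pt n) (p : Pt n) (X : (Fin n → ℂ) × (Fin n → ℂ)) :
    (Fin n → ℂ) × (Fin n → ℂ) :=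
  (fun l => vecApp n X (fun w => f w l) p,
   fun l => vecApp n X (fun w => (starRingEnd ℂ) (f w l)) p)

/-- Conjugation of a coefficient tuple. -/
def conjVec {n : ℕ} (X : Fin n → ℂ) : Fin n → ℂ := fun j => (starRingEnd ℂ) (X j)

/-- A C^k CR-diffeomorphism between ∂Ω₁ and ∂Ω₂, presented by a C^k map f on a
neighborhood U₁ of ∂Ω₁ together with a C^k local inverse g: f maps ∂Ω₁ onto ∂Ω₂
diffeomorphically and its differential maps T^{1,0}(∂Ω₁) into T^{1,0}(∂Ω₂). -/
def IsCRDiffeo (n : ℕ) (k : ℕ∞) (Ω₁ Ω₂ : Set (Pt n)) (ρ₁ ρ₂ : Pt n → ℝ)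
    (f g : Pt n → Pt n) (U₁ U₂ : Set (Pt n)) : Prop :=
  IsOpen U₁ ∧ IsOpen U₂ ∧ frontier Ω₁ ⊆ U₁ ∧ frontier Ω₂ ⊆ U₂ ∧
  (∀ l, ContDiffOn ℝ k (fun z => f z l) U₁) ∧
  (∀ l, ContDiffOn ℝ k (fun z => g z l) U₂) ∧
  f '' frontier Ω₁ = frontier Ω₂ ∧
  (∀ p ∈ frontier Ω₁, g (f p) = p) ∧ (∀ q ∈ frontier Ω₂, f (g q) = q) ∧
  (∀ p ∈ frontier Ω₁, ∀ L ∈ T10 n ρ₁ p,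
    (push n f p (L, 0)).2 = 0 ∧ (push n f p (L, 0)).1 ∈ T10 n ρ₂ (f p))

/-- The 1-form d^c ψ = i(∂̄ψ − ∂ψ) of a real function ψ. -/
def dcForm (n : ℕ) (ψ : Pt n → ℝ) : Form1 n :=
  ⟨fun z j => -Complex.I * dZ n (cR n ψ) j z, fun z j => Complex.I * dZb n (cR n ψ) j z⟩

end

section Wirtinger

variable {n : ℕ} {f g : Pt n → ℂ} {z : Pt n}

lemma dZ_congr (h : f =ᶠ[nhds z] g) (j : Fin n) : dZ n f j z = dZ n g j z := by
  simp only [dZ, h.fderiv_eq]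

lemma dZ_const (c : ℂ) (j : Fin n) : dZ n (fun _ => c) j z = 0 := by simp [dZ]

lemma dZ_neg (j : Fin n) : dZ n (fun w => -f w) j z = -dZ n f j z := by
  simp only [dZ, fderiv_fun_neg, neg_apply]
  ring

lemma dZ_mul (hf : DifferentiableAt ℝ f z) (hg : DifferentiableAt ℝ g z) (j : Fin n) :
    dZ n (fun w => f w * g w) j z = dZ n f j z * g z + f z * dZ n g j z := by
  simp only [dZ, fderiv_fun_mul hf hg, add_apply,
    smul_apply, smul_eq_mul]
  ring

lemma dZ_sum {ι : Type*} {s : Finset ι} {F : ι → Pt n → ℂ}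
    (hF : ∀ i ∈ s, DifferentiableAt ℝ (F i) z) (j : Fin n) :
    dZ n (fun w => ∑ i ∈ s, F i w) j z = ∑ i ∈ s, dZ n (F i) j z := by
  simp only [dZ, fderiv_fun_sum hF, sum_apply, Finset.mul_sum,
    ← Finset.sum_sub_distrib]

lemma fderiv_conj_apply (v : Pt n) :
    fderiv ℝ (fun w => (starRingEnd ℂ) (f w)) z v = (starRingEnd ℂ) (fderiv ℝ f z v) := by
  have h := Complex.conjCLE.comp_fderiv (f := f) (x := z)
  have h' := congrArg (fun A => A v) h
  simpa [Function.comp_def] using h'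

lemma dZ_conj (j : Fin n) :
    dZ n (fun w => (starRingEnd ℂ) (f w)) j z = (starRingEnd ℂ) (dZb n f j z) := by
  simp [dZ, dZb, fderiv_conj_apply, sub_eq_add_neg, Complex.conj_ofNat]

lemma dZb_conj (j : Fin n) :
    dZb n (fun w => (starRingEnd ℂ) (f w)) j z = (starRingEnd ℂ) (dZ n f j z) := by
  simp [dZ, dZb, fderiv_conj_apply, sub_eq_add_neg, Complex.conj_ofNat]

lemma contDiffAt_dZ {m l : ℕ} (hf : ContDiffAt ℝ l f z) (h : m + 1 ≤ l) (j : Fin n) :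
    ContDiffAt ℝ m (dZ n f j) z := by
  have hd : ContDiffAt ℝ m (fderiv ℝ f) z := hf.fderiv_right (by exact_mod_cast h)
  unfold dZ
  exact contDiffAt_const.mul ((hd.clm_apply contDiffAt_const).sub
    (contDiffAt_const.mul (hd.clm_apply contDiffAt_const)))

lemma contDiffAt_dZb {m l : ℕ} (hf : ContDiffAt ℝ l f z) (h : m + 1 ≤ l) (j : Fin n) :
    ContDiffAt ℝ m (dZb n f j) z := by
  have hd : ContDiffAt ℝ m (fderiv ℝ f) z := hf.fderiv_right (by exact_mod_cast h)
  unfold dZb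
  exact contDiffAt_const.mul ((hd.clm_apply contDiffAt_const).add
    (contDiffAt_const.mul (hd.clm_apply contDiffAt_const)))

lemma fderiv_fderiv_combination {v w : Pt n} {c : ℂ} (hf : ContDiffAt ℝ 2 f z) (u : Pt n) :
    fderiv ℝ (fun x => (1 / 2 : ℂ) * (fderiv ℝ f x v + c * fderiv ℝ f x w)) z u =
      (1 / 2 : ℂ) * (fderiv ℝ (fderiv ℝ f) z u v + c * fderiv ℝ (fderiv ℝ f) z u w) := by
  have hd : DifferentiableAt ℝ (fderiv ℝ f) z :=
    (hf.fderiv_right (m := 1) (by norm_num)).differentiableAt (by norm_num)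
  have hv (v : Pt n) : HasFDerivAt (fun x => fderiv ℝ f x v)
      ((fderiv ℝ (fderiv ℝ f) z).flip v) z := by
    simpa using hd.hasFDerivAt.clm_apply (hasFDerivAt_const v z)
  rw [(((hv v).fun_add ((hv w).const_mul c)).const_mul (1 / 2 : ℂ)).fderiv]
  simp [mul_add]

lemma fderiv_dZb (hf : ContDiffAt ℝ 2 f z) (k : Fin n) (u : Pt n) :
    fderiv ℝ (dZb n f k) z u = (1 / 2 : ℂ) * (fderiv ℝ (fderiv ℝ f) z u (Pi.single k 1) +
      Complex.I * fderiv ℝ (fderiv ℝ f) z u (Pi.single k Complex.I)) :=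
  fderiv_fderiv_combination hf u

lemma fderiv_dZ (hf : ContDiffAt ℝ 2 f z) (k : Fin n) (u : Pt n) :
    fderiv ℝ (dZ n f k) z u = (1 / 2 : ℂ) * (fderiv ℝ (fderiv ℝ f) z u (Pi.single k 1) -
      Complex.I * fderiv ℝ (fderiv ℝ f) z u (Pi.single k Complex.I)) := by
  have h := fderiv_fderiv_combination (v := Pi.single k 1) (w := Pi.single k Complex.I)
    (c := -Complex.I) hf u
  simp only [neg_mul, ← sub_eq_add_neg] at h
  exact h

lemma dZ_dZb_comm (hf : ContDiffAt ℝ 2 f z) (j k : Fin n) :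
    dZ n (dZb n f k) j z = dZb n (dZ n f j) k z := by
  have hs : IsSymmSndFDerivAt ℝ f z := hf.isSymmSndFDerivAt (by simp)
  rw [dZ, dZb, fderiv_dZb hf, fderiv_dZb hf, fderiv_dZ hf, fderiv_dZ hf,
    hs.eq (Pi.single k 1) (Pi.single j 1), hs.eq (Pi.single k 1) (Pi.single j Complex.I),
    hs.eq (Pi.single k Complex.I) (Pi.single j 1),
    hs.eq (Pi.single k Complex.I) (Pi.single j Complex.I)]
  ring

lemma dZ_dZ_comm (hf : ContDiffAt ℝ 2 f z) (j k : Fin n) :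
    dZ n (dZ n f k) j z = dZ n (dZ n f j) k z := by
  have hs : IsSymmSndFDerivAt ℝ f z := hf.isSymmSndFDerivAt (by simp)
  rw [dZ, dZ, fderiv_dZ hf, fderiv_dZ hf, fderiv_dZ hf, fderiv_dZ hf,
    hs.eq (Pi.single k 1) (Pi.single j 1), hs.eq (Pi.single k 1) (Pi.single j Complex.I),
    hs.eq (Pi.single k Complex.I) (Pi.single j 1),
    hs.eq (Pi.single k Complex.I) (Pi.single j Complex.I)]
  ring

lemma dZb_cR (ρ : Pt n → ℝ) (j : Fin n) :
    dZb n (cR n ρ) j z = (starRingEnd ℂ) (dZ n (cR n ρ) j z) := by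
  have h : cR n ρ = fun w => (starRingEnd ℂ) (cR n ρ w) := by
    funext w
    simp [cR]
  conv_lhs => rw [h, dZb_conj]

end Wirtinger

section DirectionalDerivative

variable {n : ℕ} {f g : Pt n → ℂ} {z : Pt n}

/-- Derivative of `f` at `z` along the (1,0)-vector `X`. -/
noncomputable def dirZ (n : ℕ) (X : Fin n → ℂ) (f : Pt n → ℂ) (z : Pt n) : ℂ :=
  ∑ m, X m * dZ n f m z

lemma dirZ_congr (h : f =ᶠ[nhds z] g) (X : Fin n → ℂ) : dirZ n X f z = dirZ n X g z := by
  simp only [dirZ, dZ_congr h]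

lemma dirZ_mul (hf : DifferentiableAt ℝ f z) (hg : DifferentiableAt ℝ g z) (X : Fin n → ℂ) :
    dirZ n X (fun w => f w * g w) z = dirZ n X f z * g z + f z * dirZ n X g z := by
  simp only [dirZ, dZ_mul hf hg, Finset.sum_mul, Finset.mul_sum, ← Finset.sum_add_distrib]
  exact Finset.sum_congr rfl fun _ _ => by ring

lemma dirZ_sum {ι : Type*} {s : Finset ι} {F : ι → Pt n → ℂ}
    (hF : ∀ i ∈ s, DifferentiableAt ℝ (F i) z) (X : Fin n → ℂ) :
    dirZ n X (fun w => ∑ i ∈ s, F i w) z = ∑ i ∈ s, dirZ n X (F i) z := by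
  simp only [dirZ, dZ_sum hF, Finset.mul_sum]
  exact Finset.sum_comm

lemma dirZ_single (j : Fin n) : dirZ n (Pi.single j 1) f z = dZ n f j z := by
  simp [dirZ, Pi.single_apply]

lemma sum_dirZ_mul_of_eventually_const {F G : Fin n → Pt n → ℂ} {c : ℂ}
    (hF : ∀ i, DifferentiableAt ℝ (F i) z) (hG : ∀ i, DifferentiableAt ℝ (G i) z)
    (h : ∀ᶠ w in nhds z, ∑ i, F i w * G i w = c) (X : Fin n → ℂ) :
    ∑ i, dirZ n X (F i) z * G i z = -∑ i, F i z * dirZ n X (G i) z := by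
  have h1 : dirZ n X (fun w => ∑ i, F i w * G i w) z = 0 := by
    rw [dirZ_congr (g := fun _ => c) h]
    simp [dirZ, dZ_const]
  rw [dirZ_sum (F := fun i w => F i w * G i w) fun i _ => (hF i).mul (hG i)] at h1
  simp only [dirZ_mul (hF _) (hG _), Finset.sum_add_distrib] at h1
  exact eq_neg_of_add_eq_zero_left h1

end DirectionalDerivative

section DefiningFunction

variable {n : ℕ} {ρ : Pt n → ℝ} {z p : Pt n}

lemma contDiffAt_cR {m : ℕ} (h : ContDiffAt ℝ m ρ z) : ContDiffAt ℝ m (cR n ρ) z :=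
  Complex.ofRealCLM.contDiff.contDiffAt.comp z h

lemma fderiv_cR_apply (h : DifferentiableAt ℝ ρ z) (v : Pt n) :
    fderiv ℝ (cR n ρ) z v = (fderiv ℝ ρ z v : ℂ) := by
  have h' := (Complex.ofRealCLM.hasFDerivAt.comp z h.hasFDerivAt).fderiv
  have h'' : fderiv ℝ (cR n ρ) z = Complex.ofRealCLM.comp (fderiv ℝ ρ z) := h'
  simp [h'']

lemma gradSq_ne_zero (h : DifferentiableAt ℝ ρ z) (h0 : fderiv ℝ ρ z ≠ 0) :
    gradSq n ρ z ≠ 0 := by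
  contrapose! h0
  have hz : ∀ j, dZ n (cR n ρ) j z = 0 := fun j => by
    have := (Finset.sum_eq_zero_iff_of_nonneg
      (fun j _ => Complex.normSq_nonneg (dZ n (cR n ρ) j z))).1 h0 j (Finset.mem_univ j)
    exact Complex.normSq_eq_zero.1 this
  have hre : ∀ j, fderiv ℝ ρ z (Pi.single j 1) = 0 := fun j => by
    have := congrArg Complex.re (hz j)
    simpa [dZ, fderiv_cR_apply h] using this
  have him : ∀ j, fderiv ℝ ρ z (Pi.single j Complex.I) = 0 := fun j => by
    have := congrArg Complex.im (hz j)
    simpa [dZ, fderiv_cR_apply h] using this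
  ext v
  have hv : v =
      ∑ j, ((v j).re • (Pi.single j 1 : Pt n) + (v j).im • (Pi.single j Complex.I : Pt n)) := by
    funext i
    simp [Finset.sum_apply, Pi.single_apply, Finset.sum_add_distrib, Complex.re_add_im]
  rw [hv]
  simp [hre, him]

lemma gradSq_eq_sum (z : Pt n) :
    (gradSq n ρ z : ℂ) = ∑ j, dZ n (cR n ρ) j z * dZb n (cR n ρ) j z := by
  simp [gradSq, dZb_cR, Complex.mul_conj]

lemma contDiffAt_gradSq (h : ContDiffAt ℝ 3 ρ z) :
    ContDiffAt ℝ 2 (fun w => (gradSq n ρ w : ℂ)) z := by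
  have hr : ContDiffAt ℝ (3 : ℕ) (cR n ρ) z := contDiffAt_cR h
  simp only [gradSq_eq_sum]
  exact ContDiffAt.sum fun j _ => (contDiffAt_dZ (m := 2) hr le_rfl j).mul
    (contDiffAt_dZb (m := 2) hr le_rfl j)

lemma contDiffAt_LnVF (h : ContDiffAt ℝ 3 ρ z) (hg : gradSq n ρ z ≠ 0) (j : Fin n) :
    ContDiffAt ℝ 2 (fun w => (LnVF n ρ).a w j) z := by
  simp only [LnVF, div_eq_mul_inv]
  exact (contDiffAt_dZb (m := 2) (contDiffAt_cR (m := 3) h) le_rfl j).mul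
    ((contDiffAt_gradSq h).inv (Complex.ofReal_ne_zero.2 hg))

lemma sum_dZ_mul_LnVF (hg : gradSq n ρ z ≠ 0) :
    ∑ j, dZ n (cR n ρ) j z * (LnVF n ρ).a z j = 1 := by
  have hg' : (gradSq n ρ z : ℂ) ≠ 0 := by exact_mod_cast hg
  simp only [LnVF, ← mul_div_assoc, ← Finset.sum_div, ← gradSq_eq_sum, div_self hg']

lemma sum_dZb_mul_conj_LnVF (hg : gradSq n ρ z ≠ 0) :
    ∑ j, dZb n (cR n ρ) j z * (starRingEnd ℂ) ((LnVF n ρ).a z j) = 1 := by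
  simpa [dZb_cR] using congrArg (starRingEnd ℂ) (sum_dZ_mul_LnVF hg)

lemma conj_mixed (h : ContDiffAt ℝ 2 ρ z) (j k : Fin n) :
    (starRingEnd ℂ) (dZ n (dZb n (cR n ρ) k) j z) = dZ n (dZb n (cR n ρ) j) k z := by
  have hr : ContDiffAt ℝ 2 (cR n ρ) z := contDiffAt_cR (m := 2) h
  rw [dZ_dZb_comm hr k j, ← dZb_conj]
  congr 1
  funext w
  simp [dZb_cR]

lemma levi_conj (h : ContDiffAt ℝ 2 ρ z) (X Y : Fin n → ℂ) :
    (starRingEnd ℂ) (levi n ρ z X Y) = levi n ρ z Y X := by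
  simp only [levi, map_sum, map_mul, Complex.conj_conj]
  rw [Finset.sum_comm]
  refine Finset.sum_congr rfl fun j _ => Finset.sum_congr rfl fun k _ => ?_
  have := conj_mixed h k j
  change (starRingEnd ℂ) (dZ n (dZb n (cR n ρ) j) k z) * _ * _ =
    dZ n (dZb n (cR n ρ) k) j z * _ * _
  rw [this]
  ring

lemma levi_add_left (X X' Y : Fin n → ℂ) :
    levi n ρ z (X + X') Y = levi n ρ z X Y + levi n ρ z X' Y := by
  simp only [levi, ← Finset.sum_add_distrib, Pi.add_apply]
  exact Finset.sum_congr rfl fun j _ => Finset.sum_congr rfl fun k _ => by ring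

lemma levi_smul_left (c : ℂ) (X Y : Fin n → ℂ) :
    levi n ρ z (c • X) Y = c * levi n ρ z X Y := by
  simp only [levi, Finset.mul_sum, Pi.smul_apply, smul_eq_mul]
  exact Finset.sum_congr rfl fun j _ => Finset.sum_congr rfl fun k _ => by ring

lemma levi_add_right (X Y Y' : Fin n → ℂ) :
    levi n ρ z X (Y + Y') = levi n ρ z X Y + levi n ρ z X Y' := by
  simp only [levi, ← Finset.sum_add_distrib, Pi.add_apply, map_add]
  exact Finset.sum_congr rfl fun j _ => Finset.sum_congr rfl fun k _ => by ring

lemma levi_smul_right (c : ℂ) (X Y : Fin n → ℂ) :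
    levi n ρ z X (c • Y) = (starRingEnd ℂ) c * levi n ρ z X Y := by
  simp only [levi, Finset.mul_sum, Pi.smul_apply, smul_eq_mul, map_mul]
  exact Finset.sum_congr rfl fun j _ => Finset.sum_congr rfl fun k _ => by ring

/-- A null vector of a positive semidefinite Levi form is in its kernel. -/
lemma levi_eq_zero_of_null (h : ContDiffAt ℝ 2 ρ z)
    (hpos : ∀ X ∈ T10 n ρ z, 0 ≤ (levi n ρ z X X).re) {A : Fin n → ℂ} (hA : A ∈ T10 n ρ z)
    (h0 : levi n ρ z A A = 0) {Y : Fin n → ℂ} (hY : Y ∈ T10 n ρ z) : levi n ρ z Y A = 0 := by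
  set B := levi n ρ z Y A with hB
  have hAY : levi n ρ z A Y = (starRingEnd ℂ) B := (levi_conj h Y A).symm
  have key (s : ℝ) : 0 ≤ -(2 * s * Complex.normSq B) +
      s ^ 2 * Complex.normSq B * (levi n ρ z Y Y).re := by
    have hmem : A + (-(s : ℂ) * (starRingEnd ℂ) B) • Y ∈ T10 n ρ z := by
      simp only [T10, Set.mem_ofPred_eq, Pi.add_apply, Pi.smul_apply, smul_eq_mul, add_mul,
        Finset.sum_add_distrib, mul_assoc, ← Finset.mul_sum] at hA hY ⊢
      simp [hA, hY]
    have hp := hpos _ hmem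
    have hval : levi n ρ z (A + (-(s : ℂ) * (starRingEnd ℂ) B) • Y)
        (A + (-(s : ℂ) * (starRingEnd ℂ) B) • Y) =
        ((-(2 * s * Complex.normSq B) : ℝ) : ℂ) +
          ((s ^ 2 * Complex.normSq B : ℝ) : ℂ) * levi n ρ z Y Y := by
      rw [levi_add_left, levi_add_right, levi_add_right, levi_smul_left, levi_smul_left,
        levi_smul_right, levi_smul_right, h0, hAY, ← hB]
      push_cast
      rw [← Complex.mul_conj]
      simp only [map_mul, map_neg, Complex.conj_ofReal, Complex.conj_conj]
      ring
    rw [hval, Complex.add_re, Complex.ofReal_re, Complex.re_ofReal_mul] at hp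
    exact hp
  by_contra hne
  have hN : 0 < Complex.normSq B := Complex.normSq_pos.2 hne
  set q := (levi n ρ z Y Y).re
  have hq : 0 ≤ q := hpos Y hY
  have hs := key (1 / (q + 1))
  have h1 : -(2 * (1 / (q + 1)) * Complex.normSq B) + (1 / (q + 1)) ^ 2 * Complex.normSq B * q =
      -(Complex.normSq B * (q + 2)) / (q + 1) ^ 2 := by
    field_simp
    ring
  rw [h1] at hs
  have h2 : 0 < Complex.normSq B * (q + 2) / (q + 1) ^ 2 := by positivity
  rw [neg_div] at hs
  linarith

/-- If `A` is a null vector of the Levi form, `levi X A` only depends on `∂ρ(X)`. -/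
lemma levi_left_of_null (h : ContDiffAt ℝ 2 ρ z) (hg : gradSq n ρ z ≠ 0)
    (hpos : ∀ X ∈ T10 n ρ z, 0 ≤ (levi n ρ z X X).re) {A : Fin n → ℂ} (hA : A ∈ T10 n ρ z)
    (h0 : levi n ρ z A A = 0) (X : Fin n → ℂ) :
    levi n ρ z X A = (∑ j, X j * dZ n (cR n ρ) j z) * levi n ρ z ((LnVF n ρ).a z) A := by
  set s := ∑ j, X j * dZ n (cR n ρ) j z with hs
  have hmem : X + (-s) • (LnVF n ρ).a z ∈ T10 n ρ z := by
    have h1 : ∑ j, (LnVF n ρ).a z j * dZ n (cR n ρ) j z = 1 := by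
      rw [← sum_dZ_mul_LnVF hg]
      exact Finset.sum_congr rfl fun j _ => mul_comm _ _
    simp only [T10, Set.mem_ofPred_eq, Pi.add_apply, Pi.smul_apply, smul_eq_mul, add_mul,
        Finset.sum_add_distrib, mul_assoc, ← Finset.mul_sum, h1, ← hs]
    ring
  have := levi_eq_zero_of_null h hpos hA h0 hmem
  rw [levi_add_left, levi_smul_left] at this
  linear_combination this

lemma dAngelo_w_eq (h : ContDiffAt ℝ 3 ρ z) (hg : ∀ᶠ w in nhds z, gradSq n ρ w ≠ 0) (j : Fin n) :
    (dAngelo n ρ).w z j =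
      ∑ m, dZ n (dZb n (cR n ρ) m) j z * (starRingEnd ℂ) ((LnVF n ρ).a z m) := by
  have hr : ContDiffAt ℝ (3 : ℕ) (cR n ρ) z := contDiffAt_cR h
  have hr2 : ContDiffAt ℝ 2 (cR n ρ) z := hr.of_le (by norm_num)
  have hP (m) : DifferentiableAt ℝ (dZ n (cR n ρ) m) z :=
    (contDiffAt_dZ (m := 2) hr le_rfl m).differentiableAt (by norm_num)
  have hPb (m) : DifferentiableAt ℝ (dZb n (cR n ρ) m) z :=
    (contDiffAt_dZb (m := 2) hr le_rfl m).differentiableAt (by norm_num)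
  have hc (m) : DifferentiableAt ℝ (fun w => (LnVF n ρ).a w m) z :=
    (contDiffAt_LnVF h hg.self_of_nhds m).differentiableAt (by norm_num)
  have hcb (m) : DifferentiableAt ℝ (fun w => (starRingEnd ℂ) ((LnVF n ρ).a w m)) z :=
    Complex.conjCLE.differentiableAt.comp z (hc m)
  have e1 := sum_dirZ_mul_of_eventually_const hP hc
    (hg.mono fun w hw => sum_dZ_mul_LnVF hw) (Pi.single j 1)
  have e2 := sum_dirZ_mul_of_eventually_const hPb hcb
    (hg.mono fun w hw => sum_dZb_mul_conj_LnVF hw) (Pi.single j 1)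
  simp only [dirZ_single] at e1 e2
  have hhalf (m) : dZ n (fun w => (1 / 2 : ℂ) * dZ n (cR n ρ) j w) m z =
      (1 / 2 : ℂ) * dZ n (dZ n (cR n ρ) m) j z := by
    rw [dZ_mul (differentiableAt_const _) (hP j), dZ_const, dZ_dZ_comm hr2]
    ring
  have hhalfb (m) : dZb n (fun w => (1 / 2 : ℂ) * dZ n (cR n ρ) j w) m z =
      (1 / 2 : ℂ) * dZ n (dZb n (cR n ρ) m) j z := by
    rw [dZ_dZb_comm hr2]
    simp only [dZb, fderiv_const_mul (hP j), smul_apply, smul_eq_mul]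
    ring
  simp only [dAngelo, Form1.neg, lieD, VF.app, TVF, etaF, hhalf, hhalfb, dZ_neg]
  have s1 : ∑ m, (LnVF n ρ).a z m * (1 / 2 * dZ n (dZ n (cR n ρ) m) j z) =
      1 / 2 * ∑ m, dZ n (dZ n (cR n ρ) m) j z * (LnVF n ρ).a z m := by
    rw [Finset.mul_sum]
    exact Finset.sum_congr rfl fun m _ => by ring
  have s2 : ∑ m, -(starRingEnd ℂ) ((LnVF n ρ).a z m) * (1 / 2 * dZ n (dZb n (cR n ρ) m) j z) =
      -(1 / 2) * ∑ m, dZ n (dZb n (cR n ρ) m) j z * (starRingEnd ℂ) ((LnVF n ρ).a z m) := by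
    rw [Finset.mul_sum]
    exact Finset.sum_congr rfl fun m _ => by ring
  have s3 : ∑ m, 1 / 2 * dZ n (cR n ρ) m z * dZ n (fun w => (LnVF n ρ).a w m) j z =
      1 / 2 * ∑ m, dZ n (cR n ρ) m z * dZ n (fun w => (LnVF n ρ).a w m) j z := by
    rw [Finset.mul_sum]
    exact Finset.sum_congr rfl fun m _ => by ring
  have s4 : ∑ m, -(1 / 2) * dZb n (cR n ρ) m z *
        -dZ n (fun w => (starRingEnd ℂ) ((LnVF n ρ).a w m)) j z =
      1 / 2 * ∑ m, dZb n (cR n ρ) m z *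
        dZ n (fun w => (starRingEnd ℂ) ((LnVF n ρ).a w m)) j z := by
    rw [Finset.mul_sum]
    exact Finset.sum_congr rfl fun m _ => by ring
  rw [s1, s2, s3, s4]
  linear_combination -(1 / 2) * e1 - (1 / 2) * e2

lemma dAngelo_t_eq (j : Fin n) :
    (dAngelo n ρ).t z j = (starRingEnd ℂ) ((dAngelo n ρ).w z j) := by
  have hη : (fun w => -(1 / 2 : ℂ) * dZb n (cR n ρ) j w) =
      fun w => (starRingEnd ℂ) (-(1 / 2 * dZ n (cR n ρ) j w)) := by
    funext w
    simp [dZb_cR, Complex.conj_ofNat]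
  have hdZb_neg (f : Pt n → ℂ) (m) : dZb n (fun w => -f w) m z = -dZb n f m z := by
    simp only [dZb, fderiv_fun_neg, neg_apply]
    ring
  simp only [dAngelo, Form1.neg, lieD, VF.app, TVF, etaF, hη]
  simp only [dZ_conj, dZb_conj]
  simp only [hdZb_neg, dZ_conj, dZb_conj, dZ_neg, map_neg, map_add, map_sum, map_mul, Complex.conj_conj, dZb_cR]
  simp only [Finset.sum_neg_distrib, map_div₀, map_one, Complex.conj_ofNat, mul_neg, neg_mul,
    neg_neg]
  ring

end DefiningFunction

section Boundary

variable {n : ℕ} {Ω V : Set (Pt n)} {ρ : Pt n → ℝ} {p : Pt n}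

lemma IsDefining.eq_zero_of_mem_frontier {s : ℕ∞} (hdef : IsDefining n s Ω ρ V)
    (hopen : IsOpen Ω) (hp : p ∈ frontier Ω) : ρ p = 0 := by
  obtain ⟨hV, hcl, hsm, hΩ, -⟩ := hdef
  have hpV : p ∈ V := hcl hp.1
  refine le_antisymm ?_ ?_
  · by_contra! hlt
    have hc : ContinuousAt ρ p := hsm.continuousOn.continuousAt (hV.mem_nhds hpV)
    obtain ⟨w, hw, hw'⟩ := ((mem_closure_iff_frequently.1 hp.1).and_eventually
      (hc.eventually (lt_mem_nhds hlt))).exists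
    rw [hΩ] at hw
    exact lt_asymm hw.2 hw'
  · by_contra! hlt
    have : p ∈ Ω := hΩ ▸ ⟨hpV, hlt⟩
    exact hp.2 (hopen.interior_eq.symm ▸ this)

lemma IsDefining.mem_frontier_of_eq_zero {s : ℕ∞} (hdef : IsDefining n s Ω ρ V)
    (hopen : IsOpen Ω) {z : Pt n} (hz : z ∈ V) (h0 : ρ z = 0) (hd : fderiv ℝ ρ z ≠ 0) :
    z ∈ frontier Ω := by
  obtain ⟨hV, -, -, hΩ, -⟩ := hdef
  rw [hopen.frontier_eq]
  refine ⟨?_, fun hmem => ?_⟩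
  · rw [mem_closure_iff_frequently]
    intro hev
    refine hd (IsLocalMin.fderiv_eq_zero ?_)
    filter_upwards [hev, hV.mem_nhds hz] with w hw hwV
    rw [h0]
    by_contra! hlt
    exact hw (hΩ ▸ ⟨hwV, hlt⟩)
  · rw [hΩ] at hmem
    exact hmem.2.ne h0

end Boundary

section LeviDerivative

variable {n : ℕ} {ρ : Pt n → ℝ} {p : Pt n}

lemma contDiffAt_mixed (h : ContDiffAt ℝ 3 ρ p) (j k : Fin n) :
    ContDiffAt ℝ 1 (fun w => dZ n (dZb n (cR n ρ) k) j w) p :=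
  contDiffAt_dZ (m := 1) (l := 2)
    (contDiffAt_dZb (m := 2) (l := 3) (contDiffAt_cR (m := 3) h) le_rfl k) le_rfl j

lemma contDiffAt_levi (h : ContDiffAt ℝ 3 ρ p) {a : Pt n → Fin n → ℂ}
    (ha : ∀ j, ContDiffAt ℝ 1 (fun w => a w j) p) :
    ContDiffAt ℝ 1 (fun w => levi n ρ w (a w) (a w)) p := by
  unfold levi
  exact ContDiffAt.sum fun j _ => ContDiffAt.sum fun k _ =>
    ((contDiffAt_mixed h j k).mul (ha j)).mul
      (Complex.conjCLE.contDiff.contDiffAt.comp p (ha k))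

/-- At a constrained local minimum of the Levi form on a level set of `ρ`, its derivative is a
real multiple of the derivative of `ρ`. -/
lemma exists_dZ_levi_eq (h : ∀ᶠ w in nhds p, ContDiffAt ℝ 3 ρ w) (hd : fderiv ℝ ρ p ≠ 0)
    {a : Pt n → Fin n → ℂ} (ha : ∀ j, ContDiffAt ℝ 1 (fun w => a w j) p)
    (hmin : IsLocalMinOn (fun w => (levi n ρ w (a w) (a w)).re) {w | ρ w = ρ p} p) :
    ∃ c : ℝ, ∀ m, dZ n (fun w => levi n ρ w (a w) (a w)) m p = c * dZ n (cR n ρ) m p := by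
  set φ : Pt n → ℝ := fun w => (levi n ρ w (a w) (a w)).re with hφ
  have hφ1 : ContDiffAt ℝ 1 φ p :=
    Complex.reCLM.contDiff.contDiffAt.comp p (contDiffAt_levi h.self_of_nhds ha)
  have hρ : DifferentiableAt ℝ ρ p := h.self_of_nhds.differentiableAt (by norm_num)
  obtain ⟨s, t, hst, heq⟩ := IsLocalExtrOn.exists_multipliers_of_hasStrictFDerivAt_1d
    (Or.inl hmin) (h.self_of_nhds.hasStrictFDerivAt (by norm_num))
    (hφ1.hasStrictFDerivAt (by norm_num))
  have ht : t ≠ 0 := by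
    rintro rfl
    have hs : s ≠ 0 := fun hs => hst (by simp [hs])
    rw [zero_smul, add_zero] at heq
    exact (smul_ne_zero hs hd) heq
  have hlevi : (fun w => levi n ρ w (a w) (a w)) =ᶠ[nhds p] cR n φ := by
    filter_upwards [h] with w hw
    exact (Complex.conj_eq_iff_re.1 (levi_conj (hw.of_le (by norm_num)) _ _)).symm
  have hval (v : Pt n) : fderiv ℝ φ p v = -(s / t) * fderiv ℝ ρ p v := by
    have hv := congrArg (fun A => A v) heq
    simp only [add_apply, smul_apply, smul_eq_mul, zero_apply] at hv
    field_simp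
    linarith
  refine ⟨-(s / t), fun m => ?_⟩
  rw [dZ_congr hlevi]
  simp only [dZ, fderiv_cR_apply hρ, fderiv_cR_apply (hφ1.differentiableAt (by norm_num)), hval]
  push_cast
  ring

/-- Leibniz expansion of the derivative of the Levi form along `L_n` at a null vector. -/
lemma dirZ_levi_of_null (h : ContDiffAt ℝ 3 ρ p) (hg : gradSq n ρ p ≠ 0)
    {a : Pt n → Fin n → ℂ} (ha : ∀ j, ContDiffAt ℝ 1 (fun w => a w j) p)
    (htan : ∀ᶠ w in nhds p, a w ∈ T10 n ρ w)
    (hpos : ∀ X ∈ T10 n ρ p, 0 ≤ (levi n ρ p X X).re) (h0 : levi n ρ p (a p) (a p) = 0) :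
    dirZ n ((LnVF n ρ).a p) (fun w => levi n ρ w (a w) (a w)) p =
      ∑ j, ∑ k, dirZ n ((LnVF n ρ).a p) (dZ n (dZb n (cR n ρ) k) j) p * a p j *
        (starRingEnd ℂ) (a p k)
      - (∑ j, a p j * dirZ n ((LnVF n ρ).a p) (dZ n (cR n ρ) j) p) *
        levi n ρ p ((LnVF n ρ).a p) (a p)
      - Complex.normSq (levi n ρ p ((LnVF n ρ).a p) (a p)) := by
  have hr : ContDiffAt ℝ (3 : ℕ) (cR n ρ) p := contDiffAt_cR h
  have h2 : ContDiffAt ℝ 2 ρ p := h.of_le (by norm_num)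
  have hP (m) : DifferentiableAt ℝ (dZ n (cR n ρ) m) p :=
    (contDiffAt_dZ (m := 2) hr le_rfl m).differentiableAt (by norm_num)
  have hPb (m) : DifferentiableAt ℝ (dZb n (cR n ρ) m) p :=
    (contDiffAt_dZb (m := 2) hr le_rfl m).differentiableAt (by norm_num)
  have hH (j k) : DifferentiableAt ℝ (dZ n (dZb n (cR n ρ) k) j) p :=
    (contDiffAt_mixed h j k).differentiableAt (by norm_num)
  have hA (j) : DifferentiableAt ℝ (fun w => a w j) p := (ha j).differentiableAt (by norm_num)
  have hAb (j) : DifferentiableAt ℝ (fun w => (starRingEnd ℂ) (a w j)) p :=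
    Complex.conjCLE.differentiableAt.comp p (hA j)
  have htanb : ∀ᶠ w in nhds p, ∑ j, (starRingEnd ℂ) (a w j) * dZb n (cR n ρ) j w = 0 :=
    htan.mono fun w hw => by simpa [dZb_cR] using congrArg (starRingEnd ℂ) hw
  set c := (LnVF n ρ).a p with hc
  set κ := levi n ρ p c (a p) with hκ
  have hnull := levi_left_of_null h2 hg hpos htan.self_of_nhds h0
  have hexp : dirZ n c (fun w => levi n ρ w (a w) (a w)) p =
      ∑ j, ∑ k, dirZ n c (dZ n (dZb n (cR n ρ) k) j) p * a p j * (starRingEnd ℂ) (a p k)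
      + levi n ρ p (fun j => dirZ n c (fun w => a w j) p) (a p)
      + levi n ρ p (a p) (fun k => (starRingEnd ℂ)
          (dirZ n c (fun w => (starRingEnd ℂ) (a w k)) p)) := by
    unfold levi
    rw [dirZ_sum (F := fun j w => ∑ k, dZ n (dZb n (cR n ρ) k) j w * a w j *
      (starRingEnd ℂ) (a w k)) fun j _ => DifferentiableAt.fun_sum fun k _ =>
        ((hH j k).mul (hA j)).mul (hAb k)]
    simp only [← Finset.sum_add_distrib, Complex.conj_conj]
    refine Finset.sum_congr rfl fun j _ => ?_
    rw [dirZ_sum (F := fun k w => dZ n (dZb n (cR n ρ) k) j w * a w j *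
      (starRingEnd ℂ) (a w k)) fun k _ => ((hH j k).mul (hA j)).mul (hAb k)]
    refine Finset.sum_congr rfl fun k _ => ?_
    rw [dirZ_mul (f := fun w => dZ n (dZb n (cR n ρ) k) j w * a w j) ((hH j k).mul (hA j)) (hAb k),
      dirZ_mul (hH j k) (hA j)]
    ring
  have e1 := sum_dirZ_mul_of_eventually_const hA hP htan c
  have e2 := sum_dirZ_mul_of_eventually_const hAb hPb htanb c
  have e3 : ∑ k, (starRingEnd ℂ) (a p k) * dirZ n c (dZb n (cR n ρ) k) p = κ := by
    rw [hκ, levi, Finset.sum_comm]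
    simp only [dirZ, Finset.mul_sum]
    exact Finset.sum_congr rfl fun k _ => Finset.sum_congr rfl fun j _ => by ring
  have e4 : levi n ρ p (a p) (fun k => (starRingEnd ℂ)
      (dirZ n c (fun w => (starRingEnd ℂ) (a w k)) p)) = -Complex.normSq κ := by
    rw [← levi_conj h2, hnull, map_mul, map_sum]
    simp only [map_mul, Complex.conj_conj, ← dZb_cR]
    rw [e2, e3, ← Complex.mul_conj]
    ring
  rw [hexp, e4, hnull, e1]
  ring

/-- The derivative of the (0,1)-part of the D'Angelo form along a null vector. -/
lemma sum_dZ_dAngelo_t (h : ∀ᶠ w in nhds p, ContDiffAt ℝ 3 ρ w)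
    (hg : ∀ᶠ w in nhds p, gradSq n ρ w ≠ 0) {A : Fin n → ℂ} (hA : A ∈ T10 n ρ p)
    (hpos : ∀ X ∈ T10 n ρ p, 0 ≤ (levi n ρ p X X).re) (h0 : levi n ρ p A A = 0) :
    ∑ l, dirZ n A (fun w => (dAngelo n ρ).t w l) p * (starRingEnd ℂ) (A l) =
      ∑ j, ∑ k, dirZ n ((LnVF n ρ).a p) (dZ n (dZb n (cR n ρ) k) j) p * A j *
        (starRingEnd ℂ) (A k)
      - (∑ j, A j * dirZ n ((LnVF n ρ).a p) (dZ n (cR n ρ) j) p) *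
        levi n ρ p ((LnVF n ρ).a p) A := by
  have h3 := h.self_of_nhds
  have hr : ContDiffAt ℝ (3 : ℕ) (cR n ρ) p := contDiffAt_cR h3
  have h2 : ContDiffAt ℝ 2 ρ p := h3.of_le (by norm_num)
  have hr2 : ContDiffAt ℝ 2 (cR n ρ) p := hr.of_le (by norm_num)
  have hP (m) : DifferentiableAt ℝ (dZ n (cR n ρ) m) p :=
    (contDiffAt_dZ (m := 2) hr le_rfl m).differentiableAt (by norm_num)
  have hH (j k) : DifferentiableAt ℝ (dZ n (dZb n (cR n ρ) k) j) p :=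
    (contDiffAt_mixed h3 j k).differentiableAt (by norm_num)
  have hc (m) : DifferentiableAt ℝ (fun w => (LnVF n ρ).a w m) p :=
    (contDiffAt_LnVF h3 hg.self_of_nhds m).differentiableAt (by norm_num)
  have ht (l) : (fun w => (dAngelo n ρ).t w l) =ᶠ[nhds p]
      fun w => ∑ m, (LnVF n ρ).a w m * dZ n (dZb n (cR n ρ) l) m w := by
    filter_upwards [h, hg.eventually_nhds] with w hw hgw
    rw [dAngelo_t_eq, dAngelo_w_eq hw hgw, map_sum]
    refine Finset.sum_congr rfl fun m _ => ?_
    rw [map_mul, Complex.conj_conj, conj_mixed (hw.of_le (by norm_num)), mul_comm]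
  have hterm (l) : dirZ n A (fun w => (dAngelo n ρ).t w l) p =
      ∑ m, dirZ n A (fun w => (LnVF n ρ).a w m) p * dZ n (dZb n (cR n ρ) l) m p
      + ∑ m, A m * dirZ n ((LnVF n ρ).a p) (dZ n (dZb n (cR n ρ) l) m) p := by
    rw [dirZ_congr (ht l), dirZ_sum
      (F := fun m w => (LnVF n ρ).a w m * dZ n (dZb n (cR n ρ) l) m w)
      fun m _ => (hc m).mul (hH m l)]
    simp only [dirZ_mul (hc _) (hH _ l), Finset.sum_add_distrib]
    congr 1
    simp only [dirZ, Finset.mul_sum]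
    rw [Finset.sum_comm]
    refine Finset.sum_congr rfl fun m _ => Finset.sum_congr rfl fun r _ => ?_
    rw [dZ_dZ_comm (contDiffAt_dZb (m := 2) hr le_rfl l)]
    ring
  set c := (LnVF n ρ).a p with hcdef
  have e1 := sum_dirZ_mul_of_eventually_const hP hc (hg.mono fun w hw => sum_dZ_mul_LnVF hw) A
  have e2 : ∑ i, dirZ n A (dZ n (cR n ρ) i) p * c i = ∑ j, A j * dirZ n c (dZ n (cR n ρ) j) p := by
    simp only [dirZ, Finset.mul_sum, Finset.sum_mul]
    rw [Finset.sum_comm]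
    refine Finset.sum_congr rfl fun m _ => Finset.sum_congr rfl fun r _ => ?_
    rw [dZ_dZ_comm hr2]
    ring
  have e3 : ∑ i, dirZ n A (fun w => (LnVF n ρ).a w i) p * dZ n (cR n ρ) i p =
      -∑ j, A j * dirZ n c (dZ n (cR n ρ) j) p := by
    rw [← e2, hcdef, e1, neg_neg]
    exact Finset.sum_congr rfl fun _ _ => mul_comm _ _
  have hnull := levi_left_of_null h2 hg.self_of_nhds hpos hA h0
    (fun m => dirZ n A (fun w => (LnVF n ρ).a w m) p)
  rw [e3] at hnull
  simp only [hterm, add_mul, Finset.sum_add_distrib]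
  have hfirst : ∑ l, (∑ m, dirZ n A (fun w => (LnVF n ρ).a w m) p *
      dZ n (dZb n (cR n ρ) l) m p) * (starRingEnd ℂ) (A l) =
      levi n ρ p (fun m => dirZ n A (fun w => (LnVF n ρ).a w m) p) A := by
    rw [levi, Finset.sum_comm]
    simp only [Finset.sum_mul]
    exact Finset.sum_congr rfl fun l _ => Finset.sum_congr rfl fun m _ => by ring
  have hsecond : ∑ l, (∑ m, A m * dirZ n c (dZ n (dZb n (cR n ρ) l) m) p) *
      (starRingEnd ℂ) (A l) = ∑ j, ∑ k, dirZ n c (dZ n (dZb n (cR n ρ) k) j) p * A j *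
        (starRingEnd ℂ) (A k) := by
    rw [Finset.sum_comm]
    simp only [Finset.sum_mul]
    exact Finset.sum_congr rfl fun l _ => Finset.sum_congr rfl fun m _ => by ring
  rw [hfirst, hsecond, hnull]
  ring

lemma dcEval_dAngelo (A : Fin n → ℂ) :
    dcEval (dAngelo n ρ) (A, 0) (0, conjVec A) p =
      -Complex.I * (∑ l, dirZ n A (fun w => (dAngelo n ρ).t w l) p * (starRingEnd ℂ) (A l) +
        (starRingEnd ℂ)
          (∑ l, dirZ n A (fun w => (dAngelo n ρ).t w l) p * (starRingEnd ℂ) (A l))) := by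
  have hw (l m) : dZb n (fun w => (dAngelo n ρ).w w l) m p =
      (starRingEnd ℂ) (dZ n (fun w => (dAngelo n ρ).t w l) m p) := by
    rw [← dZb_conj]
    simp only [dAngelo_t_eq, Complex.conj_conj]
  have h1 : delEval (dAngelo n ρ) (A, 0) (0, conjVec A) p =
      ∑ l, dirZ n A (fun w => (dAngelo n ρ).t w l) p * (starRingEnd ℂ) (A l) := by
    simp only [delEval, conjVec, Pi.zero_apply, mul_zero, zero_mul, sub_zero,
      Finset.sum_const_zero, zero_add, dirZ, Finset.sum_mul]
    rw [Finset.sum_comm]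
    exact Finset.sum_congr rfl fun l _ => Finset.sum_congr rfl fun m _ => by ring
  have h2 : delbEval (dAngelo n ρ) (A, 0) (0, conjVec A) p = -(starRingEnd ℂ)
      (∑ l, dirZ n A (fun w => (dAngelo n ρ).t w l) p * (starRingEnd ℂ) (A l)) := by
    simp only [delbEval, conjVec, Pi.zero_apply, mul_zero, zero_mul, sub_zero, zero_sub,
      Finset.sum_const_zero, add_zero, dirZ, Finset.sum_mul, hw, map_sum, map_mul,
      Complex.conj_conj, ← Finset.sum_neg_distrib]
    rw [Finset.sum_comm]
    exact Finset.sum_congr rfl fun l _ => Finset.sum_congr rfl fun m _ => by ring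
  rw [dcEval, h1, h2]
  ring

end LeviDerivative

/-- Proposition 4.6: at Levi-degenerate boundary points,
|Levi_ρ(L,N)|²/‖∇ρ‖² + (1/2) N(Levi_ρ(L,L))/‖∇ρ‖ = (i/8)(d^c α)(L, L̄) for the
D'Angelo 1-form α = α_ρ. -/
theorem levi_N_eq_dc_dAngelo
    (n k : ℕ) (hn : 2 ≤ n) (hk : 3 ≤ k)
    (Ω : Set (Pt n)) (hopen : IsOpen Ω) (hconn : IsConnected Ω)
    (hbdd : Bornology.IsBounded Ω)
    (ρ : Pt n → ℝ) (V : Set (Pt n)) (hdef : IsDefining n (k : ℕ∞) Ω ρ V)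
    (hpsc : LeviPseudoconvex n ρ Ω)
    (U : Set (Pt n)) (hU : IsOpen U) (hUfr : frontier Ω ⊆ U)
    (a : Pt n → Fin n → ℂ)
    (hsm : ∀ j, ContDiffOn ℝ (⊤ : ℕ∞) (fun w => a w j) U)
    (htan : ∀ z ∈ U, ∑ j, a z j * dZ n (cR n ρ) j z = 0)
    (p : Pt n) (hp : p ∈ frontier Ω)
    (h0 : levi n ρ p (a p) (a p) = 0) :
    ((Complex.normSq (levi n ρ p (a p) ((NVF n ρ).a p)) / (gradNorm n ρ p) ^ 2 : ℝ) : ℂ)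
      + (1 / 2 : ℂ) * VF.app (NVF n ρ) (fun w => levi n ρ w (a w) (a w)) p /
          (gradNorm n ρ p : ℂ)
    = (Complex.I / 8) * dcEval (dAngelo n ρ) (a p, 0) (0, conjVec (a p)) p := by
  obtain ⟨hV, hcl, hsmρ, -, hne⟩ := id hdef
  have hpV : p ∈ V := hcl hp.1
  have hpU : p ∈ U := hUfr hp
  have hC : ∀ᶠ w in nhds p, ContDiffAt ℝ 3 ρ w := by
    filter_upwards [hV.mem_nhds hpV] with w hw
    exact (hsmρ.contDiffAt (hV.mem_nhds hw)).of_le (WithTop.coe_le_coe.2 (Nat.cast_le (α := ℕ∞).2 hk))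
  have h3 := hC.self_of_nhds
  have h2 : ContDiffAt ℝ 2 ρ p := h3.of_le (by norm_num)
  have hd : fderiv ℝ ρ p ≠ 0 := hne p hp
  have hdnear : ∀ᶠ w in nhds p, fderiv ℝ ρ w ≠ 0 :=
    (h3.fderiv_right (m := 2) (by norm_num)).continuousAt.eventually_ne hd
  have hg : ∀ᶠ w in nhds p, gradSq n ρ w ≠ 0 := by
    filter_upwards [hC, hdnear] with w hw hdw
    exact gradSq_ne_zero (hw.differentiableAt (by norm_num)) hdw
  have ha : ∀ j, ContDiffAt ℝ 1 (fun w => a w j) p := fun j =>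
    ((hsm j).contDiffAt (hU.mem_nhds hpU)).of_le (by exact_mod_cast le_top)
  have htan' : ∀ᶠ w in nhds p, a w ∈ T10 n ρ w := by
    filter_upwards [hU.mem_nhds hpU] with w hw using htan w hw
  have hpos := hpsc p hp
  have hρp : ρ p = 0 := hdef.eq_zero_of_mem_frontier hopen hp
  have hmin : IsLocalMinOn (fun w => (levi n ρ w (a w) (a w)).re) {w | ρ w = ρ p} p := by
    rw [IsLocalMinOn, IsMinFilter, eventually_nhdsWithin_iff]
    filter_upwards [hV.mem_nhds hpV, hdnear, htan'] with w hwV hdw htw hw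
    rw [h0, Complex.zero_re]
    exact hpsc w (hdef.mem_frontier_of_eq_zero hopen hwV (hw.trans hρp) hdw) _ htw
  obtain ⟨c, hc⟩ := exists_dZ_levi_eq hC hd ha hmin
  have hLn : dirZ n ((LnVF n ρ).a p) (fun w => levi n ρ w (a w) (a w)) p = c := by
    simp only [dirZ, hc]
    calc _ = (c : ℂ) * ∑ j, dZ n (cR n ρ) j p * (LnVF n ρ).a p j := by
          rw [Finset.mul_sum]
          exact Finset.sum_congr rfl fun j _ => by ring
      _ = c := by rw [sum_dZ_mul_LnVF hg.self_of_nhds, mul_one]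
  have hgpos : 0 < gradSq n ρ p :=
    lt_of_le_of_ne (Finset.sum_nonneg fun _ _ => Complex.normSq_nonneg _) hg.self_of_nhds.symm
  have hs : 0 < Real.sqrt (gradSq n ρ p) := Real.sqrt_pos.2 hgpos
  have hs2 : Real.sqrt (gradSq n ρ p) ^ 2 = gradSq n ρ p := Real.sq_sqrt hgpos.le
  have hN : (NVF n ρ).a p = ((Real.sqrt (gradSq n ρ p) : ℝ) : ℂ) • (LnVF n ρ).a p := by
    funext j
    have hsC : ((Real.sqrt (gradSq n ρ p) : ℝ) : ℂ) ≠ 0 := Complex.ofReal_ne_zero.2 hs.ne'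
    have hs2C : (gradSq n ρ p : ℂ) = ((Real.sqrt (gradSq n ρ p) : ℝ) : ℂ) ^ 2 := by
      rw [← Complex.ofReal_pow, hs2]
    simp only [NVF, LnVF, Pi.smul_apply, smul_eq_mul]
    rw [hs2C]
    field_simp
  have hNapp : VF.app (NVF n ρ) (fun w => levi n ρ w (a w) (a w)) p =
      ((Real.sqrt (gradSq n ρ p) * c : ℝ) : ℂ) := by
    have hb : (NVF n ρ).b p = 0 := rfl
    rw [VF.app, hN, hb, Complex.ofReal_mul, ← hLn]
    simp [dirZ, Finset.mul_sum, mul_assoc]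
  set κ := levi n ρ p ((LnVF n ρ).a p) (a p) with hκ
  have hleviN : Complex.normSq (levi n ρ p (a p) ((NVF n ρ).a p)) =
      gradSq n ρ p * Complex.normSq κ := by
    rw [hN, levi_smul_right, ← levi_conj h2 ((LnVF n ρ).a p) (a p), ← hκ]
    simp [Complex.normSq_mul, Complex.normSq_conj, Complex.normSq_ofReal, Real.mul_self_sqrt hgpos.le]
  have hsum : ∑ l, dirZ n (a p) (fun w => (dAngelo n ρ).t w l) p * (starRingEnd ℂ) (a p l) =
      ((c + Complex.normSq κ : ℝ) : ℂ) := by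
    have e1 := dirZ_levi_of_null h3 hg.self_of_nhds ha htan' hpos h0
    rw [hLn] at e1
    rw [sum_dZ_dAngelo_t hC hg htan'.self_of_nhds hpos h0]
    push_cast
    linear_combination -e1
  have hR : Complex.I / 8 * dcEval (dAngelo n ρ) (a p, 0) (0, conjVec (a p)) p =
      ((1 / 4 * (c + Complex.normSq κ) : ℝ) : ℂ) := by
    rw [dcEval_dAngelo, hsum, Complex.conj_ofReal]
    push_cast
    linear_combination (-(1 / 4) * ((c : ℂ) + Complex.normSq κ)) * Complex.I_sq
  rw [hR, hNapp, hleviN, gradNorm]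
  have hreal : gradSq n ρ p * Complex.normSq κ / (2 * Real.sqrt (gradSq n ρ p)) ^ 2 +
      1 / 2 * (Real.sqrt (gradSq n ρ p) * c) / (2 * Real.sqrt (gradSq n ρ p)) =
      1 / 4 * (c + Complex.normSq κ) := by
    rw [mul_pow, hs2]
    field_simp
    ring
  rw [← hreal]
  push_cast
  rfl
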